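/- arXiv:1309.6591 — 6 statements merged into one kernel-verified Lean document; each statement's English description precedes it below -/
import Mathlib

section
/- Let q be a prime power, m ≥ 1, and E a finite field with q^m elements. A function f : E → E is induced by a polynomial with coefficients in the subfield F_q = {x ∈ E : x^q = x} if and only if f ∘ φ_q = φ_q ∘ f, where φ_q : E → E is the Frobenius map φ_q(x) = x^q. -/
/-- A polynomial function on a finite field `E` commutes with an endomorphism `σ` of `E` if its
coefficients are fixed by `σ`, and every function commuting with `σ` arises in this way. -/
theorem exists_polynomial_fixed_coeff_iff_commute {E : Type*} [Field E] [Fintype E]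
    (σ : E →+* E) (f : E → E) :
    (∃ g : Polynomial E, (∀ i, σ (g.coeff i) = g.coeff i) ∧ ∀ x, f x = g.eval x) ↔
      ∀ x, f (σ x) = σ (f x) := by
  classical
  constructor
  · rintro ⟨g, hg, hf⟩ x
    have hmap : g.map σ = g := by
      ext i
      rw [Polynomial.coeff_map, hg]
    rw [hf, hf, ← Polynomial.eval_map_apply, hmap]
  · intro hf
    have hinj : Set.InjOn (id : E → E) (Finset.univ : Finset E) := Function.injective_id.injOn
    set g := Lagrange.interpolate Finset.univ id f
    have heval (x : E) : g.eval x = f x :=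
      Lagrange.eval_interpolate_at_node f hinj (Finset.mem_univ x)
    have hdeg : g.degree < (Finset.univ : Finset E).card := Lagrange.degree_interpolate_lt f hinj
    have hmap : g.map σ = g := by
      refine Polynomial.eq_of_degrees_lt_of_eval_finset_eq Finset.univ
        (by rwa [Polynomial.degree_map]) hdeg fun y _ => ?_
      obtain ⟨x, rfl⟩ := Finite.surjective_of_injective σ.injective y
      rw [Polynomial.eval_map_apply, heval, heval, hf]
    refine ⟨g, fun i => ?_, fun x => (heval x).symm⟩
    rw [← Polynomial.coeff_map, hmap]

/-- A function `f : E → E` on a finite field `E` with `q ^ m` elements is induced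
by a polynomial with coefficients in the subfield `F_q = {x : E | x ^ q = x}` if and only if
`f` commutes with the Frobenius map `x ↦ x ^ q`. -/
theorem stmt_0 (q m : ℕ) (hq : IsPrimePow q) (hm : 1 ≤ m)
    (E : Type*) [Field E] [Fintype E] (hE : Fintype.card E = q ^ m)
    (f : E → E) :
    (∃ g : Polynomial E, (∀ i, g.coeff i ^ q = g.coeff i) ∧ ∀ x, f x = g.eval x) ↔
      ∀ x, f (x ^ q) = f x ^ q := by
  obtain ⟨p, k, hp, -, rfl⟩ := hq
  have : Fact p.Prime := ⟨hp.nat_prime⟩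
  have : CharP E p := charP_of_card_eq_prime_pow (hE.trans (pow_mul p k m).symm)
  simpa only [iterateFrobenius_def] using
    exists_polynomial_fixed_coeff_iff_commute (iterateFrobenius E p k) f
end

section
/- Let n, k ≥ 1 and let ψ be a permutation of a finite set S with exactly n orbits, each of cardinality k (so |S| = nk). Then the number of maps g : S → S satisfying g ∘ ψ = ψ ∘ g equals n^n · k^n. -/
namespace Equiv.Perm

variable {S : Type*}

theorem range_zpow_apply_eq_orbit (ψ : Perm S) (x : S) :
    Set.range (fun j : ℤ => (ψ ^ j) x) = MulAction.orbit (Subgroup.zpowers ψ) x := by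
  ext y
  constructor
  · rintro ⟨j, rfl⟩
    exact ⟨⟨ψ ^ j, j, rfl⟩, rfl⟩
  · rintro ⟨⟨_, j, rfl⟩, rfl⟩
    exact ⟨j, rfl⟩

/-- Any two points whose orbits have the same size are fixed by the same powers. -/
theorem zpow_apply_eq_zpow_apply_of_ncard_range_eq [Finite S] (ψ : Perm S) {x y : S}
    (hxy : (Set.range fun j : ℤ => (ψ ^ j) x).ncard = (Set.range fun j : ℤ => (ψ ^ j) y).ncard)
    {a b : ℤ} (h : (ψ ^ a) x = (ψ ^ b) x) : (ψ ^ a) y = (ψ ^ b) y := by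
  have key (z : S) : (ψ ^ a) z = (ψ ^ b) z ↔
      ((Set.range fun j : ℤ => (ψ ^ j) z).ncard : ℤ) ∣ a - b := by
    have := Fintype.ofFinite (MulAction.orbit (Subgroup.zpowers ψ) z)
    rw [range_zpow_apply_eq_orbit, ← Nat.card_coe_set_eq, Nat.card_eq_fintype_card,
      ← MulAction.minimalPeriod_eq_card, ← MulAction.zpow_smul_eq_iff_minimalPeriod_dvd,
      sub_eq_neg_add, zpow_add, mul_smul, zpow_neg, inv_smul_eq_iff]
    rfl
  rw [key] at h ⊢
  rwa [← hxy]

theorem apply_zpow_of_commute {ψ : Perm S} {g : S → S} (hg : ∀ x, g (ψ x) = ψ (g x))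
    (j : ℤ) (x : S) : g ((ψ ^ j) x) = (ψ ^ j) (g x) := by
  induction j generalizing x with
  | zero => rfl
  | succ i ih => rw [zpow_add_one, mul_apply, ih, hg, mul_apply]
  | pred i ih =>
    have h : g (ψ⁻¹ x) = ψ⁻¹ (g x) := by
      rw [eq_inv_iff_eq, ← hg]
      exact congrArg g (ψ.apply_symm_apply x)
    rw [zpow_sub_one, mul_apply, ih, h, mul_apply]

theorem range_zpow_apply_eq_iff (ψ : Perm S) {x y : S} :
    (Set.range fun j : ℤ => (ψ ^ j) x) = (Set.range fun j : ℤ => (ψ ^ j) y) ↔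
      ψ.SameCycle x y := by
  simp only [range_zpow_apply_eq_orbit, MulAction.orbit_eq_iff]
  rw [← range_zpow_apply_eq_orbit, sameCycle_comm]
  rfl

/-- If all orbits of `ψ` have the same size, a map commuting with `ψ` is determined by its values
on a system of representatives of the orbits, and these values are arbitrary. -/
theorem bijective_restrict_section [Finite S] (ψ : Perm S) {k : ℕ}
    (hsize : ∀ x : S, (Set.range fun j : ℤ => (ψ ^ j) x).ncard = k)
    {Q : Type*} {p : S → Q} (hp : ∀ x y, p x = p y ↔ ψ.SameCycle x y)
    {s : Q → S} (hs : ∀ q, p (s q) = q) :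
    Function.Bijective
      fun (g : {g : S → S // ∀ x, g (ψ x) = ψ (g x)}) (q : Q) => g.1 (s q) := by
  have hcyc (x : S) : ∃ j : ℤ, (ψ ^ j) (s (p x)) = x := (hp _ _).1 (hs _)
  constructor
  · rintro ⟨g, hg⟩ ⟨g', hg'⟩ h
    ext x
    obtain ⟨j, hj⟩ := hcyc x
    have := congrFun h (p x)
    dsimp only at this ⊢
    rw [← hj, apply_zpow_of_commute hg, apply_zpow_of_commute hg', this]
  · intro f
    choose i hi using hcyc
    have transfer {x y : S} {a b : ℤ} (h : (ψ ^ a) x = (ψ ^ b) x) : (ψ ^ a) y = (ψ ^ b) y :=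
      ψ.zpow_apply_eq_zpow_apply_of_ncard_range_eq ((hsize x).trans (hsize y).symm) h
    refine ⟨⟨fun x => (ψ ^ i x) (f (p x)), fun x => ?_⟩, funext fun q => ?_⟩
    · have hpx : p (ψ x) = p x := (hp _ _).2 (sameCycle_apply_left.2 .rfl)
      have h := hi (ψ x)
      dsimp only
      rw [hpx] at h ⊢
      rw [← mul_apply, ← zpow_one_add]
      refine transfer (x := s (p x)) ?_
      rw [h, zpow_one_add, mul_apply, hi]
    · have h := hi (s q)
      rw [hs] at h
      dsimp only
      rw [hs]
      exact transfer (b := 0) h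

end Equiv.Perm


/-- If a permutation `ψ` of a finite set `S` has exactly `n` orbits, each of
cardinality `k`, then the number of maps `g : S → S` commuting with `ψ` equals `n^n * k^n`. -/
theorem stmt_4 (S : Type*) [Fintype S] (n k : ℕ) (hn : 1 ≤ n) (hk : 1 ≤ k)
    (ψ : Equiv.Perm S)
    (horbits : {O : Set S | ∃ x : S, O = Set.range fun j : ℤ => (ψ ^ j) x}.ncard = n)
    (hsize : ∀ x : S, (Set.range fun j : ℤ => (ψ ^ j) x).ncard = k) :
    Nat.card {g : S → S // ∀ x, g (ψ x) = ψ (g x)} = n ^ n * k ^ n := by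
  set Q := {O : Set S | ∃ x : S, O = Set.range fun j : ℤ => (ψ ^ j) x}
  let p (x : S) : Q := ⟨Set.range fun j : ℤ => (ψ ^ j) x, x, rfl⟩
  have hp (x y : S) : p x = p y ↔ ψ.SameCycle x y :=
    Subtype.ext_iff.trans ψ.range_zpow_apply_eq_iff
  have hsurj : Function.Surjective p := fun ⟨_, x, hx⟩ => ⟨x, Subtype.ext hx.symm⟩
  choose s hs using hsurj
  have hQ : Nat.card Q = n := horbits
  have hfiber (q : Q) : Nat.card {x // p x = q} = k := by
    rw [← hsize (s q)]
    refine congrArg Set.ncard (Set.ext fun x => ?_)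
    change p x = q ↔ ψ.SameCycle (s q) x
    rw [← hp, hs, eq_comm]
  have hS : Nat.card S = n * k := by
    have := Fintype.ofFinite Q
    rw [← Nat.card_congr (Equiv.sigmaFiberEquiv p), Nat.card_sigma]
    simp only [hfiber, Finset.sum_const, Finset.card_univ, smul_eq_mul]
    rw [← Nat.card_eq_fintype_card, hQ]
  rw [Nat.card_eq_of_bijective _ (ψ.bijective_restrict_section hsize hp hs), Nat.card_fun, hS, hQ,
    mul_pow]
end

section
/- Let q be a prime power, m ≥ 1, and E a finite field with q^m elements. The number of functions f : E → E that are both induced by a polynomial with coefficients in F_q and subfield preserving equals ∏_{k | m} k^{π(k)} · π(k)^{π(k)}, where π(k) is the number of monic irreducible polynomials of degree k over F_q. -/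
open Polynomial IntermediateField

theorem minpoly_aeval_eq_of_minpoly_eq {F E : Type*} [Field F] [Field E]
    [Algebra F E] [FiniteDimensional F E] {x y : E} (h : minpoly F x = minpoly F y) (g : F[X]) :
    minpoly F (aeval x g) = minpoly F (aeval y g) := by
  refine (minpoly.eq_of_irreducible_of_monic (minpoly.irreducible (.of_finite F _)) ?_
    (minpoly.monic (.of_finite F _))).symm
  rw [← aeval_comp, ← minpoly.dvd_iff, h, minpoly.dvd_iff, aeval_comp, minpoly.aeval]

section FiniteField

variable {F : Type*} [Field F] [Finite F]

/-- An irreducible polynomial over a finite field splits in every finite extension whose degree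
is a multiple of the degree of the polynomial. -/
theorem Irreducible.splits_map_of_natDegree_dvd_finrank {K : Type*} [Field K] [Algebra F K]
    [Finite K] {P : F[X]} (hP : Irreducible P) (h : P.natDegree ∣ Module.finrank F K) :
    (P.map (algebraMap F K)).Splits := by
  have := Fintype.ofFinite K
  have := Fintype.ofFinite F
  have hdvd := hP.natDegree_dvd_iff_dvd_X_pow_card_pow_sub_X.1 h
  rw [Nat.card_eq_fintype_card, ← Module.card_eq_pow_finrank] at hdvd
  exact (FiniteField.isSplittingField_sub K F).splits.of_dvd
    (map_ne_zero (FiniteField.X_pow_card_sub_X_ne_zero _ Fintype.one_lt_card))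
    ((map_dvd_map' _).mpr hdvd)

variable {E : Type*} [Field E] [Algebra F E] [Finite E]

theorem minpoly.natDegree_dvd_iff_pow_card_pow_eq (y : E) (d : ℕ) :
    (minpoly F y).natDegree ∣ d ↔ y ^ Nat.card F ^ d = y := by
  have hy : IsIntegral F y := .of_finite F y
  rw [(minpoly.irreducible hy).natDegree_dvd_iff_dvd_X_pow_card_pow_sub_X, minpoly.dvd_iff]
  simp [sub_eq_zero]

theorem exists_aeval_eq_of_natDegree_minpoly_dvd {x y : E}
    (h : (minpoly F y).natDegree ∣ (minpoly F x).natDegree) : ∃ g : F[X], aeval x g = y := by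
  have hx : IsIntegral F x := .of_finite F x
  have hy : IsIntegral F y := .of_finite F y
  rw [← adjoin.finrank hx] at h
  have hs := (minpoly.irreducible hy).splits_map_of_natDegree_dvd_finrank h
  have hmem := hs.mem_range_of_isRoot (Polynomial.map_ne_zero (minpoly.ne_zero hy))
    (i := algebraMap F⟮x⟯ E) (x := y) (by
      rw [Polynomial.map_map, ← IsScalarTower.algebraMap_eq, IsRoot.def, eval_map_algebraMap,
        minpoly.aeval])
  obtain ⟨z, rfl⟩ := hmem
  have hz : (z : E) ∈ F⟮x⟯.toSubalgebra := z.2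
  rw [adjoin_simple_toSubalgebra_of_isAlgebraic hx.isAlgebraic,
    Algebra.adjoin_singleton_eq_range_aeval] at hz
  exact hz

theorem subfieldPreserving_iff_natDegree_minpoly {m : ℕ} (hm : Module.finrank F E = m)
    (f : E → E) :
    ((∀ x ∈ {y : E | y ^ Nat.card F = y}, f x ∈ {y : E | y ^ Nat.card F = y}) ∧
      ∀ d s, d ∣ m → s ∣ m →
        ∀ x ∈ {y : E | y ^ Nat.card F ^ d = y} \ {y : E | y ^ Nat.card F ^ s = y},
          f x ∈ {y : E | y ^ Nat.card F ^ d = y} \ {y : E | y ^ Nat.card F ^ s = y}) ↔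
    ∀ x, (minpoly F (f x)).natDegree = (minpoly F x).natDegree := by
  have h1 (y : E) : y ^ Nat.card F = y ↔ (minpoly F y).natDegree ∣ 1 := by
    rw [minpoly.natDegree_dvd_iff_pow_card_pow_eq, pow_one]
  have hdvd (y : E) : (minpoly F y).natDegree ∣ m :=
    hm ▸ minpoly.degree_dvd (.of_finite F y)
  simp only [h1, Set.mem_sdiff, Set.mem_ofPred_eq, ← minpoly.natDegree_dvd_iff_pow_card_pow_eq]
  constructor
  · rintro ⟨hone, hf⟩ x
    have hle : (minpoly F (f x)).natDegree ∣ (minpoly F x).natDegree := by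
      by_cases hx : (minpoly F x).natDegree ∣ 1
      · exact (hone x hx).trans (one_dvd _)
      · exact (hf _ 1 (hdvd x) (one_dvd m) x ⟨dvd_rfl, hx⟩).1
    refine Nat.dvd_antisymm hle ?_
    by_contra hx
    exact (hf _ _ (hdvd x) (hdvd (f x)) x ⟨dvd_rfl, hx⟩).2 dvd_rfl
  · intro hf
    simp only [hf]
    exact ⟨fun _ h => h, fun _ _ _ _ _ h => h⟩

theorem exists_minpoly_eq_of_natDegree_dvd_finrank {P : F[X]} (hP : P.Monic) (hi : Irreducible P)
    (h : P.natDegree ∣ Module.finrank F E) : ∃ x : E, minpoly F x = P := by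
  obtain ⟨x, hx⟩ := (hi.splits_map_of_natDegree_dvd_finrank h).exists_eval_eq_zero
    (by rw [degree_map]; exact hi.degree_pos.ne')
  exact ⟨x, (minpoly.eq_of_irreducible_of_monic hi (by rwa [eval_map_algebraMap] at hx) hP).symm⟩

/-- The monic irreducible polynomials of degree `k`. -/
abbrev MonicIrreducible (F : Type*) [Field F] (k : ℕ) : Type _ :=
  {P : F[X] // P.Monic ∧ Irreducible P ∧ P.natDegree = k}

variable (F E) in
theorem finite_monicIrreducible {k : ℕ} (hk : k ∣ Module.finrank F E) :
    Finite (MonicIrreducible F k) := by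
  choose r hr using fun P : MonicIrreducible F k =>
    exists_minpoly_eq_of_natDegree_dvd_finrank (E := E) P.2.1 P.2.2.1 (P.2.2.2.symm ▸ hk)
  exact .of_injective r fun P Q h => Subtype.ext (by rw [← hr P, ← hr Q, h])

variable (F E) in
theorem card_natDegree_minpoly_eq {k : ℕ} (hk : k ∣ Module.finrank F E) :
    Nat.card {y : E // (minpoly F y).natDegree = k} = k * Nat.card (MonicIrreducible F k) := by
  have := finite_monicIrreducible F E hk
  have := Fintype.ofFinite (MonicIrreducible F k)
  let p (y : {y : E // (minpoly F y).natDegree = k}) : MonicIrreducible F k :=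
    ⟨minpoly F y.1, minpoly.monic (.of_finite F _), minpoly.irreducible (.of_finite F _), y.2⟩
  have hfib (P : MonicIrreducible F k) : Nat.card {y // p y = P} = k := by
    have e : {y // p y = P} ≃ P.1.rootSet E :=
      { toFun y := ⟨y.1.1, by
          have h : minpoly F y.1.1 = P.1 := congrArg Subtype.val y.2
          rw [mem_rootSet, ← h]
          exact ⟨minpoly.ne_zero (.of_finite F _), minpoly.aeval F _⟩⟩
        invFun y :=
          have h : P.1 = minpoly F y.1 := minpoly.eq_of_irreducible_of_monic P.2.2.1
            (aeval_eq_zero_of_mem_rootSet y.2) P.2.1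
          ⟨⟨y.1, h ▸ P.2.2.2⟩, Subtype.ext h.symm⟩
        left_inv _ := rfl
        right_inv _ := rfl }
    rw [Nat.card_congr e, Nat.card_eq_fintype_card, card_rootSet_eq_natDegree
      (PerfectField.separable_of_irreducible P.2.2.1)
      (P.2.2.1.splits_map_of_natDegree_dvd_finrank (P.2.2.2.symm ▸ hk)), P.2.2.2]
  rw [← Nat.card_congr (Equiv.sigmaFiberEquiv p), Nat.card_sigma]
  simp [hfib, mul_comm]

theorem exists_forall_aeval_eq {ι : Type*} [Finite ι] {x y : ι → E}
    (hx : Function.Injective fun i => minpoly F (x i))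
    (h : ∀ i, (minpoly F (y i)).natDegree ∣ (minpoly F (x i)).natDegree) :
    ∃ g : F[X], ∀ i, aeval (x i) g = y i := by
  choose a ha using fun i => exists_aeval_eq_of_natDegree_minpoly_dvd (h i)
  have hcop : Pairwise (Function.onFun IsCoprime fun i => Ideal.span {minpoly F (x i)}) := by
    intro i j hij
    have hi := minpoly.irreducible (A := F) (.of_finite F (x i))
    have hj := minpoly.irreducible (A := F) (.of_finite F (x j))
    rw [Function.onFun, Ideal.isCoprime_span_singleton_iff, hi.coprime_iff_not_dvd]
    exact fun hd => hij (hx (eq_of_monic_of_associated (minpoly.monic (.of_finite F _))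
      (minpoly.monic (.of_finite F _)) (hi.associated_of_dvd hj hd)))
  obtain ⟨g, hg⟩ := Ideal.exists_forall_sub_mem_ideal hcop a
  refine ⟨g, fun i => ?_⟩
  have := hg i
  rw [Ideal.mem_span_singleton, minpoly.dvd_iff, map_sub, sub_eq_zero] at this
  rw [this, ha]

variable (F E) in
theorem card_polynomial_natDegree_minpoly_preserving :
    Nat.card {f : E → E // (∃ g : F[X], ∀ x, f x = aeval x g) ∧
        ∀ x, (minpoly F (f x)).natDegree = (minpoly F x).natDegree} =
      ∏ k ∈ (Module.finrank F E).divisors,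
        (k * Nat.card (MonicIrreducible F k)) ^ Nat.card (MonicIrreducible F k) := by
  have hk (k : (Module.finrank F E).divisors) := Nat.dvd_of_mem_divisors k.2
  have (k : (Module.finrank F E).divisors) := finite_monicIrreducible F E (hk k)
  choose r hr using fun (k : (Module.finrank F E).divisors) (P : MonicIrreducible F k) =>
    exists_minpoly_eq_of_natDegree_dvd_finrank (E := E) P.2.1 P.2.2.1 (P.2.2.2.symm ▸ hk k)
  have hcover (x : E) : ∃ k P, minpoly F (r k P) = minpoly F x :=
    ⟨⟨_, Nat.mem_divisors.2 ⟨minpoly.degree_dvd (.of_finite F x), Module.finrank_pos.ne'⟩⟩,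
      ⟨minpoly F x, minpoly.monic (.of_finite F _), minpoly.irreducible (.of_finite F _), rfl⟩,
      hr _ _⟩
  let Φ (f : {f : E → E // (∃ g : F[X], ∀ x, f x = aeval x g) ∧
      ∀ x, (minpoly F (f x)).natDegree = (minpoly F x).natDegree})
      (k : (Module.finrank F E).divisors) (P : MonicIrreducible F k) :
      {y : E // (minpoly F y).natDegree = k} :=
    ⟨f.1 (r k P), by rw [f.2.2, hr, P.2.2.2]⟩
  have hΦ : Function.Bijective Φ := by
    constructor
    · rintro ⟨f₁, ⟨g₁, hg₁⟩, h₁⟩ ⟨f₂, ⟨g₂, hg₂⟩, h₂⟩ h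
      refine Subtype.ext (funext fun x => ?_)
      obtain ⟨k, P, hP⟩ := hcover x
      have hfg : f₁ (r k P) = f₂ (r k P) := congrArg Subtype.val (congrFun (congrFun h k) P)
      change f₁ x = f₂ x
      rw [hg₁, hg₂, ← sub_eq_zero, ← map_sub, ← minpoly.dvd_iff] at hfg ⊢
      rwa [← hP]
    · intro t
      obtain ⟨g, hg⟩ := exists_forall_aeval_eq (F := F)
        (ι := Σ k : (Module.finrank F E).divisors, MonicIrreducible F k)
        (x := fun i => r i.1 i.2) (y := fun i => (t i.1 i.2).1) (by
          rintro ⟨⟨k, hk⟩, ⟨P, hP⟩⟩ ⟨⟨l, hl⟩, ⟨Q, hQ⟩⟩ h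
          simp only [hr] at h
          subst h
          obtain rfl : k = l := hP.2.2.symm.trans hQ.2.2
          rfl) (fun i => by rw [(t i.1 i.2).2, hr, i.2.2.2.2])
      refine ⟨⟨fun x => aeval x g, ⟨g, fun _ => rfl⟩, fun x => ?_⟩,
        funext fun k => funext fun P => Subtype.ext (hg ⟨k, P⟩)⟩
      obtain ⟨k, P, hP⟩ := hcover x
      rw [← minpoly_aeval_eq_of_minpoly_eq hP, ← hP, hg ⟨k, P⟩, (t k P).2, hr, P.2.2.2]
  rw [Nat.card_eq_of_bijective Φ hΦ, Nat.card_pi, ← Finset.prod_coe_sort _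
    fun k => (k * Nat.card (MonicIrreducible F k)) ^ Nat.card (MonicIrreducible F k)]
  exact Finset.prod_congr rfl fun k _ => by
    rw [Nat.card_fun, card_natDegree_minpoly_eq F E (hk k)]

end FiniteField


/-- The number of functions `f : E → E` on a finite field with `q ^ m` elements
that are both induced by a polynomial with coefficients in `F_q` and subfield preserving
equals `∏_{k ∣ m} k ^ π(k) · π(k) ^ π(k)`, where `π(k)` is the number of monic irreducible
polynomials of degree `k` over `F_q`. -/
theorem stmt_8 (q m : ℕ) (hq : IsPrimePow q) (hm : 1 ≤ m)
    (F E : Type*) [Field F] [Fintype F] [Field E] [Fintype E] [Algebra F E]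
    (hF : Fintype.card F = q) (hE : Fintype.card E = q ^ m)
    (π : ℕ → ℕ)
    (hπ : ∀ k, π k = Nat.card {P : Polynomial F // P.Monic ∧ Irreducible P ∧ P.natDegree = k}) :
    Nat.card {f : E → E //
        (∃ g : Polynomial F, ∀ x, f x = Polynomial.aeval x g) ∧
          (∀ x ∈ {y : E | y ^ q = y}, f x ∈ {y : E | y ^ q = y}) ∧
          ∀ d s, d ∣ m → s ∣ m →
            ∀ x ∈ {y : E | y ^ q ^ d = y} \ {y : E | y ^ q ^ s = y},
              f x ∈ {y : E | y ^ q ^ d = y} \ {y : E | y ^ q ^ s = y}} =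
      ∏ k ∈ m.divisors, k ^ π k * π k ^ π k := by
  subst hF
  have hfin : Module.finrank F E = m := by
    rw [Module.card_eq_pow_finrank (K := F)] at hE
    exact Nat.pow_right_injective Fintype.one_lt_card hE
  have hcard := card_polynomial_natDegree_minpoly_preserving F E
  rw [hfin] at hcard
  simp only [← mul_pow, hπ]
  rw [← hcard, ← Nat.card_eq_fintype_card]
  exact Nat.card_congr (Equiv.subtypeEquivRight fun f =>
    and_congr_right' (subfieldPreserving_iff_natDegree_minpoly hfin f))
end

section
/- Let q be a prime power, m ≥ 1, and E a finite field with q^m elements. The number of subfield preserving functions f : E → E (with no restriction on coefficients) equals ∏_{k | m} (k · π(k))^{k · π(k)}, where π(k) is the number of monic irreducible polynomials of degree k over F_q. -/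
open Polynomial in
theorem FiniteField.pow_card_pow_eq_self_iff_natDegree_minpoly_dvd
    {F E : Type*} [Field F] [Fintype F] [Field E] [Fintype E] [Algebra F E] (x : E) (d : ℕ) :
    x ^ Fintype.card F ^ d = x ↔ (minpoly F x).natDegree ∣ d := by
  have hx : IsIntegral F x := Algebra.IsIntegral.isIntegral x
  rw [(minpoly.irreducible hx).natDegree_dvd_iff_dvd_X_pow_card_pow_sub_X, minpoly.dvd_iff,
    Nat.card_eq_fintype_card]
  simp [sub_eq_zero]

open Polynomial in
theorem FiniteField.card_rootSet_of_irreducible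
    {F E : Type*} [Field F] [Fintype F] [Field E] [Fintype E] [Algebra F E] {m : ℕ}
    (hE : Fintype.card E = Fintype.card F ^ m) {P : F[X]} (hP : Irreducible P)
    (hd : P.natDegree ∣ m) : Nat.card (P.rootSet E) = P.natDegree := by
  have hdvd : P ∣ X ^ Fintype.card E - X := by
    rw [hE, ← Nat.card_eq_fintype_card]
    exact hP.natDegree_dvd_iff_dvd_X_pow_card_pow_sub_X.1 hd
  rw [Nat.card_eq_fintype_card]
  refine card_rootSet_eq_natDegree (PerfectField.separable_of_irreducible hP) ?_
  have hs : ((X ^ Fintype.card E - X : E[X])).Splits := by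
    rw [splits_iff_card_roots, FiniteField.roots_X_pow_card_sub_X,
      FiniteField.X_pow_card_sub_X_natDegree_eq _ Fintype.one_lt_card]
    rfl
  refine hs.of_dvd (FiniteField.X_pow_card_sub_X_ne_zero _ Fintype.one_lt_card) ?_
  simpa using map_dvd (mapRingHom (algebraMap F E)) hdvd

open Polynomial in
theorem FiniteField.card_natDegree_minpoly_eq
    {F E : Type*} [Field F] [Fintype F] [Field E] [Fintype E] [Algebra F E] {m k : ℕ}
    (hE : Fintype.card E = Fintype.card F ^ m) (hm : m ≠ 0) (hk : k ∣ m) :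
    Nat.card {x : E // (minpoly F x).natDegree = k} =
      k * Nat.card {P : F[X] // P.Monic ∧ Irreducible P ∧ P.natDegree = k} := by
  have hint (x : E) : IsIntegral F x := Algebra.IsIntegral.isIntegral x
  let e : {x : E // (minpoly F x).natDegree = k} ≃
      Σ P : {P : F[X] // P.Monic ∧ Irreducible P ∧ P.natDegree = k}, P.1.rootSet E :=
    { toFun := fun x => ⟨⟨minpoly F x.1, minpoly.monic (hint _), minpoly.irreducible (hint _), x.2⟩,
        ⟨x.1, by simp [mem_rootSet, minpoly.ne_zero (hint x.1)]⟩⟩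
      invFun := fun y => ⟨y.2.1, by
        rw [← minpoly.eq_of_irreducible_of_monic y.1.2.2.1 (mem_rootSet.1 y.2.2).2 y.1.2.1]
        exact y.1.2.2.2⟩
      left_inv := fun x => rfl
      right_inv := by
        rintro ⟨⟨P, hP⟩, x, hx⟩
        obtain rfl := minpoly.eq_of_irreducible_of_monic hP.2.1 (mem_rootSet.1 hx).2 hP.1
        rfl }
  have hroot (P : {P : F[X] // P.Monic ∧ Irreducible P ∧ P.natDegree = k}) :
      Nat.card (P.1.rootSet E) = k := by
    rw [FiniteField.card_rootSet_of_irreducible hE P.2.2.1 (P.2.2.2.dvd.trans hk), P.2.2.2]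
  have : Finite {P : F[X] // P.Monic ∧ Irreducible P ∧ P.natDegree = k} := by
    refine Finite.of_surjective (fun x => (e x).1) fun P => ?_
    have : Nonempty (P.1.rootSet E) :=
      (Nat.card_ne_zero.1 (by rw [hroot]; exact ne_zero_of_dvd_ne_zero hm hk)).1
    exact ⟨e.symm ⟨P, this.some⟩, by simp⟩
  have := Fintype.ofFinite {P : F[X] // P.Monic ∧ Irreducible P ∧ P.natDegree = k}
  rw [Nat.card_congr e, Nat.card_sigma, Finset.sum_congr rfl fun P _ => hroot P]
  simp [mul_comm]

theorem Nat.card_comp_eq_self {α β : Type*} [Fintype α] [DecidableEq β] (g : α → β) (s : Finset β)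
    (hs : ∀ x, g x ∈ s) :
    Nat.card {f : α → α // ∀ x, g (f x) = g x} =
      ∏ k ∈ s, Nat.card {x // g x = k} ^ Nat.card {x // g x = k} := by
  rw [Nat.card_congr (Equiv.subtypePiEquivPi (p := fun x y => g y = g x)), Nat.card_pi,
    ← Finset.prod_fiberwise_of_maps_to (g := g) (t := s) fun x _ => hs x]
  refine Finset.prod_congr rfl fun k _ => ?_
  rw [Finset.prod_congr rfl fun x hx => by rw [(Finset.mem_filter.1 hx).2], Finset.prod_const]
  simp [Fintype.card_subtype]


/-- The number of subfield preserving functions `f : E → E` (no restriction on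
coefficients) on a finite field with `q ^ m` elements equals
`∏_{k ∣ m} (k · π(k)) ^ (k · π(k))`, where `π(k)` is the number of monic irreducible
polynomials of degree `k` over `F_q`. -/
theorem stmt_10 (q m : ℕ) (hq : IsPrimePow q) (hm : 1 ≤ m)
    (F E : Type*) [Field F] [Fintype F] [Field E] [Fintype E] [Algebra F E]
    (hF : Fintype.card F = q) (hE : Fintype.card E = q ^ m)
    (π : ℕ → ℕ)
    (hπ : ∀ k, π k = Nat.card {P : Polynomial F // P.Monic ∧ Irreducible P ∧ P.natDegree = k}) :
    Nat.card {f : E → E //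
        (∀ x ∈ {y : E | y ^ q = y}, f x ∈ {y : E | y ^ q = y}) ∧
          ∀ d s, d ∣ m → s ∣ m →
            ∀ x ∈ {y : E | y ^ q ^ d = y} \ {y : E | y ^ q ^ s = y},
              f x ∈ {y : E | y ^ q ^ d = y} \ {y : E | y ^ q ^ s = y}} =
      ∏ k ∈ m.divisors, (k * π k) ^ (k * π k) := by
  subst hF
  have hm0 : m ≠ 0 := Nat.one_le_iff_ne_zero.1 hm
  have hdvd (x : E) : (minpoly F x).natDegree ∣ m := by
    rw [← FiniteField.pow_card_pow_eq_self_iff_natDegree_minpoly_dvd, ← hE, FiniteField.pow_card]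
  have hmem1 (x : E) : x ^ Fintype.card F = x ↔ (minpoly F x).natDegree ∣ 1 := by
    rw [← FiniteField.pow_card_pow_eq_self_iff_natDegree_minpoly_dvd, pow_one]
  simp only [Set.mem_sdiff, Set.mem_ofPred_eq, hmem1,
    FiniteField.pow_card_pow_eq_self_iff_natDegree_minpoly_dvd]
  have hiff (f : E → E) :
      ((∀ x, (minpoly F x).natDegree ∣ 1 → (minpoly F (f x)).natDegree ∣ 1) ∧
        ∀ d s, d ∣ m → s ∣ m → ∀ x,
          (minpoly F x).natDegree ∣ d ∧ ¬ (minpoly F x).natDegree ∣ s →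
          (minpoly F (f x)).natDegree ∣ d ∧ ¬ (minpoly F (f x)).natDegree ∣ s) ↔
      ∀ x, (minpoly F (f x)).natDegree = (minpoly F x).natDegree := by
    refine ⟨fun ⟨h1, h2⟩ x => ?_, fun h => by simp [h]⟩
    by_cases hx : (minpoly F x).natDegree ∣ 1
    · rw [Nat.dvd_one.1 hx, Nat.dvd_one.1 (h1 x hx)]
    · refine Nat.dvd_antisymm (h2 _ 1 (hdvd x) (one_dvd m) x ⟨dvd_rfl, hx⟩).1 ?_
      by_contra hs
      exact (h2 _ _ (hdvd x) (hdvd (f x)) x ⟨dvd_rfl, hs⟩).2 dvd_rfl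
  rw [Nat.card_congr (Equiv.subtypeEquivRight hiff),
    Nat.card_comp_eq_self (fun x : E => (minpoly F x).natDegree) m.divisors
      fun x => Nat.mem_divisors.2 ⟨hdvd x, hm0⟩]
  refine Finset.prod_congr rfl fun k hk => ?_
  rw [FiniteField.card_natDegree_minpoly_eq hE hm0 (Nat.dvd_of_mem_divisors hk), hπ]
end

section
/- Fix a prime p. For a prime power q, let T(q) denote the number of functions of a finite field with q^p elements that are both induced by a polynomial with coefficients in F_q and subfield preserving (so T(q) = q^q · (q^p − q)^{(q^p − q)/p}). Then T(q) / q^{q^p} tends to 0 as q tends to infinity over the prime powers. -/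
open Filter

theorem Nat.Prime.dvd_pow_self_sub_self {p : ℕ} (hp : p.Prime) (q : ℕ) : p ∣ q ^ p - q := by
  have := Fact.mk hp
  refine (Nat.modEq_iff_dvd' (Nat.le_self_pow hp.ne_zero q)).1 ?_
  rw [← ZMod.natCast_eq_natCast_iff]
  simp

theorem subfieldPreserving_ratio_le_exp {p q : ℕ} (hp : p.Prime) (hq : 2 ≤ q) :
    ((q ^ q * (q ^ p - q) ^ ((q ^ p - q) / p) : ℕ) : ℝ) / (q : ℝ) ^ (q ^ p) ≤
      Real.exp (-((q : ℝ) / (2 * p))) := by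
  have hle : q ≤ q ^ p := Nat.le_self_pow hp.ne_zero q
  have h2 : 2 * q ≤ q ^ p := calc
    2 * q ≤ q * q := Nat.mul_le_mul_right q hq
    _ = q ^ 2 := (sq q).symm
    _ ≤ q ^ p := Nat.pow_le_pow_right (by omega) hp.two_le
  obtain ⟨m, hm⟩ := hp.dvd_pow_self_sub_self q
  have hdiv : (q ^ p - q) / p = m := by rw [hm, Nat.mul_div_cancel_left m hp.pos]
  have hsum : q ^ p = q + p * m := by omega
  have hq0 : (0 : ℝ) < q := by exact_mod_cast (by omega : 0 < q)
  have hp0 : (0 : ℝ) < p := by exact_mod_cast hp.pos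
  have hN : (0 : ℝ) < (q : ℝ) ^ p := by positivity
  have h2' : 2 * (q : ℝ) ≤ (q : ℝ) ^ p := by exact_mod_cast h2
  have hsum' : (q : ℝ) ^ p = q + p * m := by exact_mod_cast hsum
  have hratio : ((q ^ q * (q ^ p - q) ^ ((q ^ p - q) / p) : ℕ) : ℝ) / (q : ℝ) ^ (q ^ p) =
      (1 - (q : ℝ) / (q : ℝ) ^ p) ^ m := by
    have hpow : (q : ℝ) ^ (q ^ p) = (q : ℝ) ^ q * ((q : ℝ) ^ p) ^ m := by
      rw [← pow_mul, ← pow_add, ← hsum]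
    rw [hdiv, hpow, Nat.cast_mul, Nat.cast_pow, Nat.cast_pow, Nat.cast_sub hle, Nat.cast_pow,
      mul_div_mul_left _ _ (by positivity), ← div_pow, sub_div, div_self hN.ne']
  have hbase : 0 ≤ 1 - (q : ℝ) / (q : ℝ) ^ p := by
    rw [sub_nonneg, div_le_one hN]
    linarith
  rw [hratio]
  calc (1 - (q : ℝ) / (q : ℝ) ^ p) ^ m
      ≤ Real.exp (-((q : ℝ) / (q : ℝ) ^ p)) ^ m :=
        pow_le_pow_left₀ hbase (Real.one_sub_le_exp_neg _) m
    _ = Real.exp (-(m * ((q : ℝ) / (q : ℝ) ^ p))) := by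
        rw [← Real.exp_nat_mul, mul_neg]
    _ ≤ Real.exp (-((q : ℝ) / (2 * p))) := by
        rw [Real.exp_le_exp, neg_le_neg_iff, mul_div_assoc', div_le_div_iff₀ (by positivity) hN]
        nlinarith

/-- Fix a prime `p`. With `T(q) = q^q · (q^p − q)^((q^p − q)/p)` the number of
canonical subfield preserving functions of `F_{q^p}`, the ratio `T(q) / q^(q^p)` tends to `0`
as `q → ∞` over the prime powers. -/
theorem stmt_15 (p : ℕ) (hp : p.Prime) :
    Tendsto
      (fun q : ℕ =>
        ((q ^ q * (q ^ p - q) ^ ((q ^ p - q) / p) : ℕ) : ℝ) / (q : ℝ) ^ (q ^ p))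
      (atTop ⊓ 𝓟 {q : ℕ | IsPrimePow q}) (nhds 0) := by
  refine Tendsto.mono_left ?_ inf_le_left
  have hexp : Tendsto (fun q : ℕ => Real.exp (-((q : ℝ) / (2 * p)))) atTop (nhds 0) :=
    Real.tendsto_exp_neg_atTop_nhds_zero.comp
      (tendsto_natCast_atTop_atTop.atTop_div_const
        (mul_pos two_pos (Nat.cast_pos.2 hp.pos)))
  refine squeeze_zero' (Eventually.of_forall fun q => by positivity) ?_ hexp
  filter_upwards [eventually_ge_atTop 2] with q hq
  exact subfieldPreserving_ratio_le_exp hp hq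
end

section
/- The real sequence a_n = n^n · (n^n − n)^{n^{n−1} − 1} / n^{n^n} tends to 1/e as the natural number n tends to infinity. -/
open Filter

theorem tendsto_one_sub_inv_pow_pred :
    Tendsto (fun m : ℕ => (1 + (-1 : ℝ) / m) ^ (m - 1)) atTop (nhds (Real.exp 1)⁻¹) := by
  have hpow := Real.tendsto_one_add_div_pow_exp (-1)
  have hbase : Tendsto (fun m : ℕ => 1 + (-1 : ℝ) / m) atTop (nhds 1) := by
    simpa using (tendsto_const_div_atTop_nhds_zero_nat (-1 : ℝ)).const_add 1
  have hquot := hpow.div hbase one_ne_zero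
  rw [div_one, Real.exp_neg] at hquot
  refine hquot.congr' ?_
  filter_upwards [eventually_ge_atTop 2] with m hm
  have hm' : (2 : ℝ) ≤ m := by exact_mod_cast hm
  have hne : 1 + (-1 : ℝ) / m ≠ 0 := by
    have : (1 : ℝ) / m < 1 := by rw [div_lt_one] <;> linarith
    rw [neg_div]
    linarith
  obtain ⟨k, rfl⟩ := Nat.exists_eq_add_of_le' (show 1 ≤ m by omega)
  simp only [Pi.div_apply, Nat.add_sub_cancel]
  rw [pow_succ, mul_div_cancel_right₀ _ hne]

theorem tendsto_pow_pred_self_atTop : Tendsto (fun n : ℕ => n ^ (n - 1)) atTop atTop := by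
  refine tendsto_atTop_mono' _ ?_ tendsto_id
  filter_upwards [eventually_ge_atTop 2] with n hn
  exact Nat.le_self_pow (by omega) n

theorem pow_self_mul_sub_pow_div_eq {n : ℕ} (hn : 1 ≤ n) :
    ((n : ℝ) ^ n * ((n : ℝ) ^ n - (n : ℝ)) ^ (n ^ (n - 1) - 1)) / (n : ℝ) ^ (n ^ n) =
      (1 + (-1 : ℝ) / (n ^ (n - 1) : ℕ)) ^ (n ^ (n - 1) - 1) := by
  have hn0 : (n : ℝ) ≠ 0 := by positivity
  have hsucc : n ^ n = n * n ^ (n - 1) := (mul_pow_sub_one (by omega) n).symm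
  have hsuccR : (n : ℝ) ^ n = n * (n : ℝ) ^ (n - 1) := by exact_mod_cast hsucc
  have hexp : n ^ (n - 1) - 1 + 1 = n ^ (n - 1) :=
    Nat.sub_add_cancel (Nat.one_le_pow _ _ hn)
  have hden : (n : ℝ) ^ (n ^ n) = (n : ℝ) ^ n * ((n : ℝ) ^ n) ^ (n ^ (n - 1) - 1) := by
    rw [← pow_succ', hexp, ← pow_mul, ← hsucc]
  rw [hden, mul_div_mul_left _ _ (pow_ne_zero _ hn0), ← div_pow]
  congr 1
  rw [hsuccR]
  push_cast
  field_simp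
  ring

/-- The real sequence `a_n = n^n · (n^n − n)^(n^(n−1) − 1) / n^(n^n)` tends to
`1/e` as `n → ∞`. -/
theorem stmt_17 :
    Tendsto
      (fun n : ℕ =>
        ((n : ℝ) ^ n * ((n : ℝ) ^ n - (n : ℝ)) ^ (n ^ (n - 1) - 1)) / (n : ℝ) ^ (n ^ n))
      atTop (nhds (Real.exp 1)⁻¹) := by
  refine (tendsto_one_sub_inv_pow_pred.comp tendsto_pow_pred_self_atTop).congr' ?_
  filter_upwards [eventually_ge_atTop 1] with n hn
  exact (pow_self_mul_sub_pow_div_eq hn).symm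
end
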